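/- There exist indices i_1,…,i_k with S_{i_1} ∪ … ∪ S_{i_k} = U (a set cover of size at most k) if and only if G_SC admits a bidirectional temporal spanner whose footprint has at most 3n + 2m + 3 + k edges. -/

import Mathlib

namespace TemporalPaper

/-- A temporal graph on vertex set `V`: an undirected labeling assigning to each
(unordered) pair of vertices a finite set of rational time labels; a pair is an
edge of the graph iff its label set is nonempty. -/
structure TemporalGraph (V : Type*) where
  label : V → V → Finset ℚ
  symm : ∀ u v, label u v = label v u
  loopless : ∀ v, label v v = ∅

namespace TemporalGraph

variable {V : Type*}

/-- The footprint (static underlying graph) of a temporal graph. -/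
def footprint (G : TemporalGraph V) : SimpleGraph V where
  Adj u v := (G.label u v).Nonempty
  symm := ⟨fun u v h => by rwa [G.symm]⟩
  loopless := ⟨fun v h => by rw [G.loopless] at h; exact Finset.not_nonempty_empty h⟩

/-- The snapshot of a temporal graph at time `t`. -/
def snapshot (G : TemporalGraph V) (t : ℚ) : SimpleGraph V where
  Adj u v := t ∈ G.label u v
  symm := ⟨fun u v h => by rwa [G.symm]⟩
  loopless := ⟨fun v h => by rw [G.loopless] at h; exact absurd h (Finset.notMem_empty t)⟩

/-- `G.IsTJ r p ts` : the list of vertices `p` together with the list of times `ts`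
(one per consecutive pair of vertices of `p`) forms a temporal walk, i.e. each time
belongs to the labels of the corresponding edge, and consecutive times satisfy `r`
(`r = (· ≤ ·)` for non-strict temporal walks, `r = (· < ·)` for strict ones). -/
inductive IsTJ (G : TemporalGraph V) (r : ℚ → ℚ → Prop) : List V → List ℚ → Prop
  | single (v : V) : IsTJ G r [v] []
  | cons {u v : V} {p : List V} {t : ℚ} {ts : List ℚ} :
      t ∈ G.label u v → IsTJ G r (v :: p) ts →
      (∀ t' ∈ ts.head?, r t t') → IsTJ G r (u :: v :: p) (t :: ts)

/-- A temporal path from `u` to `v` with underlying (vertex-)path `p` and times `ts`. -/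
def TPath (G : TemporalGraph V) (r : ℚ → ℚ → Prop) (u v : V)
    (p : List V) (ts : List ℚ) : Prop :=
  G.IsTJ r p ts ∧ p.Nodup ∧ p.head? = some u ∧ p.getLast? = some v

/-- Temporal reachability. -/
def Reach (G : TemporalGraph V) (r : ℚ → ℚ → Prop) (u v : V) : Prop :=
  ∃ p ts, G.TPath r u v p ts

def TemporallyConnectedRel (G : TemporalGraph V) (r : ℚ → ℚ → Prop) : Prop :=
  ∀ u v : V, u ≠ v → G.Reach r u v

/-- Temporal connectivity (non-strict setting). -/
def TemporallyConnected (G : TemporalGraph V) : Prop :=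
  G.TemporallyConnectedRel (· ≤ ·)

/-- A bidirectional temporal path (bi-path) between `u` and `v` on the underlying
path `p` (from `u` to `v`): a temporal path in each direction along `p`. -/
def BiPath (G : TemporalGraph V) (r : ℚ → ℚ → Prop) (u v : V)
    (p : List V) (ts₁ ts₂ : List ℚ) : Prop :=
  G.TPath r u v p ts₁ ∧ G.TPath r v u p.reverse ts₂

def BiConnectedRel (G : TemporalGraph V) (r : ℚ → ℚ → Prop) : Prop :=
  ∀ u v : V, u ≠ v → ∃ p ts₁ ts₂, G.BiPath r u v p ts₁ ts₂

/-- Bidirectional temporal connectivity (non-strict setting). -/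
def BiConnected (G : TemporalGraph V) : Prop := G.BiConnectedRel (· ≤ ·)

/-- `H` is a temporal subgraph of `G` (on the same vertex set). -/
def IsSubgraph (H G : TemporalGraph V) : Prop := ∀ u v, H.label u v ⊆ G.label u v

/-- A temporal spanner of `G`: a temporally connected temporal subgraph on all of `V`. -/
def IsSpanner (H G : TemporalGraph V) : Prop := H.IsSubgraph G ∧ H.TemporallyConnected

/-- A temporal spanning tree of `G`: a temporal spanner whose footprint is a tree. -/
def IsSpanningTree (H G : TemporalGraph V) : Prop := H.IsSpanner G ∧ H.footprint.IsTree

/-- A bidirectional temporal spanner (bi-spanner) of `G`. -/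
def IsBiSpanner (H G : TemporalGraph V) : Prop := H.IsSpanner G ∧ H.BiConnected

/-- A temporal graph is simple if every edge has exactly one time label,
i.e. every label set has at most one element (edges have nonempty label sets). -/
def Simple (G : TemporalGraph V) : Prop := ∀ u v, (G.label u v).card ≤ 1

/-- A temporal graph is proper if any two (distinct) edges sharing a vertex have
disjoint label sets. -/
def Proper (G : TemporalGraph V) : Prop :=
  ∀ u v w : V, v ≠ w → Disjoint (G.label u v) (G.label u w)

def Happy (G : TemporalGraph V) : Prop := G.Simple ∧ G.Proper

/-- `u` can reach `v` by a (non-strict) temporal path arriving at time at most `t`. -/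
def ArrivesBy (G : TemporalGraph V) (u v : V) (t : ℚ) : Prop :=
  ∃ p ts, G.TPath (· ≤ ·) u v p ts ∧ ∀ t' ∈ ts.getLast?, t' ≤ t

/-- `u` can reach `v` by a (non-strict) temporal path departing at time at least `t`. -/
def DepartsAfter (G : TemporalGraph V) (u v : V) (t : ℚ) : Prop :=
  ∃ p ts, G.TPath (· ≤ ·) u v p ts ∧ ∀ t' ∈ ts.head?, t ≤ t'

/-- A pivot: some time `t` such that every other vertex reaches `x` by time `t`
and `x` reaches every other vertex departing not earlier than `t`. -/
def IsPivot (G : TemporalGraph V) (x : V) : Prop :=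
  ∃ t : ℚ, ∀ u : V, u ≠ x → G.ArrivesBy u x t ∧ G.DepartsAfter x u t

/-- Deleting the (undirected) edge `ab` from a temporal graph. -/
def deleteEdge [DecidableEq V] (G : TemporalGraph V) (a b : V) : TemporalGraph V where
  label u v := if (u = a ∧ v = b) ∨ (u = b ∧ v = a) then ∅ else G.label u v
  symm := by
    intro u v
    have h : ((u = a ∧ v = b) ∨ (u = b ∧ v = a)) ↔ ((v = a ∧ u = b) ∨ (v = b ∧ u = a)) := by
      tauto
    rw [G.symm, if_congr h rfl rfl]
  loopless := by
    intro v
    split_ifs with h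
    · rfl
    · exact G.loopless v

end TemporalGraph

end TemporalPaper

namespace TemporalPaper

open TemporalGraph

/-- Vertices of the temporal graph `G_SC` built from a Set Cover instance with
universe `U = {u_1, …, u_n}` and subsets `S_1, …, S_m`: one vertex per element of `U`,
one vertex per subset, and three auxiliary vertices `v`, `v₁`, `v₂`. -/
inductive Vsc (n m : ℕ) : Type
  | elem : Fin n → Vsc n m
  | set : Fin m → Vsc n m
  | v : Vsc n m
  | v1 : Vsc n m
  | v2 : Vsc n m
deriving DecidableEq

/-- One orientation of the labeling of `G_SC` (indices taken `1`-based as in the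
paper): `v s_i` and, for `u_j ∈ S_i`, `s_i u_j` carry label `i`; `v₁ s_i` and
`v₁ u_j` carry label `m+1`; `v₂ v` and `v₂ s_i` carry label `m+2`; finally the edges
`v₁ v`, `v₁ v₂` and `v₂ u_j` carry pairwise distinct labels (`m+3`, `m+4` and
`m+5+j`) distinct from all other labels of the graph. -/
def coreSC (n m : ℕ) (S : Fin m → Finset (Fin n)) : Vsc n m → Vsc n m → Finset ℚ
  | .v, .set i => {(i : ℚ) + 1}
  | .set i, .elem j => if j ∈ S i then {(i : ℚ) + 1} else ∅
  | .v1, .set _ => {(m : ℚ) + 1}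
  | .v1, .elem _ => {(m : ℚ) + 1}
  | .v2, .v => {(m : ℚ) + 2}
  | .v2, .set _ => {(m : ℚ) + 2}
  | .v1, .v => {(m : ℚ) + 3}
  | .v1, .v2 => {(m : ℚ) + 4}
  | .v2, .elem j => {(m : ℚ) + 5 + (j : ℚ)}
  | _, _ => ∅

/-- The simple temporal graph `G_SC` of the reduction from Set Cover to `k`-BS. -/
def Gsc (n m : ℕ) (S : Fin m → Finset (Fin n)) : TemporalGraph (Vsc n m) where
  label a b := coreSC n m S a b ∪ coreSC n m S b a
  symm := fun a b => Finset.union_comm _ _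
  loopless := fun a => by cases a <;> simp [coreSC]

end TemporalPaper

namespace TemporalPaper

namespace TemporalGraph

variable {V : Type*} {G H : TemporalGraph V}

/-- In a non-strict temporal walk, the first time is at most some label of the last edge. -/
theorem IsTJ.exists_head_le_last {p : List V} {ts : List ℚ} (h : G.IsTJ (· ≤ ·) p ts) :
    ∀ {q : List V} {y w : V}, p = q ++ [y, w] →
      ∃ s t, ts.head? = some s ∧ s ≤ t ∧ t ∈ G.label y w := by
  induction h with
  | single v =>
    intro q y w hq
    have := congrArg List.length hq
    simp at this
  | @cons a b p t ts hmem _ hle ih =>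
    intro q y w hq
    cases q with
    | nil =>
      obtain ⟨rfl, rfl, rfl⟩ : a = y ∧ b = w ∧ p = [] := by simpa using hq
      exact ⟨t, t, rfl, le_rfl, hmem⟩
    | cons c q =>
      obtain ⟨s, t', hs, hst, ht'⟩ := ih (List.cons.inj hq).2
      exact ⟨t, t', rfl, (hle s hs).trans hst, ht'⟩

/-- The first label of a non-strict temporal walk is at most some label of the last edge. -/
theorem IsTJ.exists_first_le_last {a x y w : V} {p q r : List V} {ts : List ℚ}
    (h : G.IsTJ (· ≤ ·) p ts) (hr : p = a :: x :: r) (hq : p = q ++ [y, w]) :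
    ∃ s ∈ G.label a x, ∃ t ∈ G.label y w, s ≤ t := by
  obtain ⟨s, t, hs, hst, ht⟩ := h.exists_head_le_last hq
  subst hr
  cases h with
  | cons hmem _ _ =>
    obtain rfl := Option.some.inj hs
    exact ⟨_, hmem, t, ht, hst⟩

/-- In a simple temporal graph, the two end edges of a bi-path share a label. -/
theorem BiPath.exists_common_label (hG : G.Simple) {u w : V} {p : List V} {ts₁ ts₂ : List ℚ}
    (h : G.BiPath (· ≤ ·) u w p ts₁ ts₂) (huw : u ≠ w) :
    ∃ t x y, t ∈ G.label u x ∧ t ∈ G.label y w := by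
  obtain ⟨⟨h₁, -, hu, hw⟩, ⟨h₂, -, -, -⟩⟩ := h
  obtain ⟨x, r, hr⟩ : ∃ x r, p = u :: x :: r := by
    match p, hu, hw with
    | [a], hu, hw => simp_all
    | a :: x :: r, hu, hw => exact ⟨x, r, by simp_all⟩
  obtain ⟨y, q, hq⟩ : ∃ y q, p = q ++ [y, w] := by
    have hlen : p.reverse.length = r.length + 2 := by simp [hr]
    have hhead : p.reverse.head? = some w := by simpa using hw
    match hp : p.reverse, hlen, hhead with
    | b :: y :: q, _, hhead =>
      refine ⟨y, q.reverse, ?_⟩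
      obtain rfl : b = w := Option.some.inj hhead
      simpa using congrArg List.reverse hp
  obtain ⟨s, hs, t, ht, hst⟩ := h₁.exists_first_le_last hr hq
  obtain ⟨t', ht', s', hs', hts⟩ :=
    h₂.exists_first_le_last (a := w) (x := y) (r := q.reverse) (q := r.reverse) (y := x) (w := u)
      (by simp [hq]) (by simp [hr])
  rw [G.symm] at ht' hs'
  obtain rfl := Finset.card_le_one.mp (hG _ _) s hs s' hs'
  obtain rfl := Finset.card_le_one.mp (hG _ _) t ht t' ht'
  obtain rfl := le_antisymm hst hts
  exact ⟨s, x, y, hs, ht⟩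

theorem IsSubgraph.simple (h : H.IsSubgraph G) (hG : G.Simple) : H.Simple :=
  fun u v => (Finset.card_le_card (h u v)).trans (hG u v)

theorem ne_of_mem_label {a b : V} {t : ℚ} (h : t ∈ G.label a b) : a ≠ b := by
  rintro rfl
  simp [G.loopless] at h

theorem BiPath.of_edge {a b : V} {t : ℚ} (h : t ∈ G.label a b) :
    G.BiPath (· ≤ ·) a b [a, b] [t] [t] := by
  have hab := ne_of_mem_label h
  have h' : t ∈ G.label b a := by rwa [G.symm]
  exact ⟨⟨.cons h (.single _) (by simp), by simp [hab], rfl, rfl⟩,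
    ⟨.cons h' (.single _) (by simp), by simp [hab.symm], rfl, rfl⟩⟩

theorem BiPath.of_two_edges {a b c : V} {t : ℚ} (hab : a ≠ b) (h₁ : t ∈ G.label a c)
    (h₂ : t ∈ G.label c b) : G.BiPath (· ≤ ·) a b [a, c, b] [t, t] [t, t] := by
  have hac := ne_of_mem_label h₁
  have hcb := ne_of_mem_label h₂
  have h₁' : t ∈ G.label c a := by rwa [G.symm]
  have h₂' : t ∈ G.label b c := by rwa [G.symm]
  exact ⟨⟨.cons h₁ (.cons h₂ (.single _) (by simp)) (by simp), by simp [hab, hac, hcb], rfl, rfl⟩,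
    ⟨.cons h₂' (.cons h₁' (.single _) (by simp)) (by simp),
      by simp [hab.symm, hac.symm, hcb.symm], rfl, rfl⟩⟩

theorem BiConnected.temporallyConnected (h : G.BiConnected) : G.TemporallyConnected := by
  intro u w huw
  obtain ⟨p, ts, -, hp, -⟩ := h u w huw
  exact ⟨p, ts, hp⟩

open Classical in
/-- The temporal subgraph of `G` keeping the labels of the pairs in `E` only. -/
noncomputable def restrict (G : TemporalGraph V) (E : Set (Sym2 V)) : TemporalGraph V where
  label a b := if s(a, b) ∈ E then G.label a b else ∅
  symm a b := by rw [Sym2.eq_swap, G.symm]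
  loopless a := by simp [G.loopless]

theorem mem_restrict_label {E : Set (Sym2 V)} {a b : V} {t : ℚ} :
    t ∈ (G.restrict E).label a b ↔ s(a, b) ∈ E ∧ t ∈ G.label a b := by
  by_cases h : s(a, b) ∈ E <;> simp [restrict, h]

theorem restrict_isSubgraph (G : TemporalGraph V) (E : Set (Sym2 V)) :
    (G.restrict E).IsSubgraph G :=
  fun _ _ _ h => (mem_restrict_label.mp h).2

theorem restrict_edgeSet_subset (G : TemporalGraph V) (E : Set (Sym2 V)) :
    (G.restrict E).footprint.edgeSet ⊆ E := by
  intro e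
  induction e with
  | _ a b =>
    rintro ⟨t, ht⟩
    exact (mem_restrict_label.mp ht).1

end TemporalGraph

section

open TemporalGraph

variable {n m : ℕ} {S : Fin m → Finset (Fin n)}

theorem Gsc_simple (S : Fin m → Finset (Fin n)) : (Gsc n m S).Simple := by
  intro a b
  cases a <;> cases b <;> simp [Gsc, coreSC] <;> split_ifs <;> simp

/-- The edges of the bi-spanner of `G_SC` determined by a set cover `I` and a choice `g` of a
covering set for every element. -/
def spannerEdge (g : Fin n → Fin m) (I : Finset (Fin m)) :
    Fin m ⊕ Fin m ⊕ I ⊕ Fin n ⊕ Fin n ⊕ Fin n ⊕ Unit ⊕ Unit ⊕ Unit → Sym2 (Vsc n m)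
  | .inl i => s(.v1, .set i)
  | .inr (.inl i) => s(.v2, .set i)
  | .inr (.inr (.inl i)) => s(.v, .set i)
  | .inr (.inr (.inr (.inl j))) => s(.v1, .elem j)
  | .inr (.inr (.inr (.inr (.inl j)))) => s(.v2, .elem j)
  | .inr (.inr (.inr (.inr (.inr (.inl j))))) => s(.set (g j), .elem j)
  | .inr (.inr (.inr (.inr (.inr (.inr (.inl _)))))) => s(.v1, .v)
  | .inr (.inr (.inr (.inr (.inr (.inr (.inr (.inl _))))))) => s(.v2, .v)
  | .inr (.inr (.inr (.inr (.inr (.inr (.inr (.inr _))))))) => s(.v1, .v2)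

theorem spannerEdge_injective (g : Fin n → Fin m) (I : Finset (Fin m)) :
    Function.Injective (spannerEdge g I) := by
  rintro (a | a | a | a | a | a | a | a | a) (b | b | b | b | b | b | b | b | b) h <;>
    simp [spannerEdge, -Subtype.forall] at h ⊢ <;> grind

theorem ncard_range_spannerEdge (g : Fin n → Fin m) (I : Finset (Fin m)) :
    (Set.range (spannerEdge g I)).ncard = 3 * n + 2 * m + 3 + I.card := by
  rw [← Set.image_univ, Set.ncard_image_of_injective _ (spannerEdge_injective g I),
    Set.ncard_univ, Nat.card_eq_fintype_card]
  simp
  ring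

theorem biConnected_restrict_spannerEdge {g : Fin n → Fin m} {I : Finset (Fin m)}
    (hg : ∀ j, g j ∈ I ∧ j ∈ S (g j)) :
    ((Gsc n m S).restrict (Set.range (spannerEdge g I))).BiConnected := by
  set H := (Gsc n m S).restrict (Set.range (spannerEdge g I)) with hH
  have hv1s (i) : (m : ℚ) + 1 ∈ H.label .v1 (.set i) :=
    mem_restrict_label.mpr ⟨⟨.inl i, rfl⟩, by simp [Gsc, coreSC]⟩
  have hv2s (i) : (m : ℚ) + 2 ∈ H.label .v2 (.set i) :=
    mem_restrict_label.mpr ⟨⟨.inr (.inl i), rfl⟩, by simp [Gsc, coreSC]⟩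
  have hvs (i) (hi : i ∈ I) : (i : ℚ) + 1 ∈ H.label .v (.set i) :=
    mem_restrict_label.mpr ⟨⟨.inr (.inr (.inl ⟨i, hi⟩)), rfl⟩, by simp [Gsc, coreSC]⟩
  have hv1u (j) : (m : ℚ) + 1 ∈ H.label .v1 (.elem j) :=
    mem_restrict_label.mpr ⟨⟨.inr (.inr (.inr (.inl j))), rfl⟩, by simp [Gsc, coreSC]⟩
  have hv2u (j) : (m : ℚ) + 5 + j ∈ H.label .v2 (.elem j) :=
    mem_restrict_label.mpr ⟨⟨.inr (.inr (.inr (.inr (.inl j)))), rfl⟩, by simp [Gsc, coreSC]⟩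
  have hsu (j) : (g j : ℚ) + 1 ∈ H.label (.set (g j)) (.elem j) :=
    mem_restrict_label.mpr ⟨⟨.inr (.inr (.inr (.inr (.inr (.inl j))))), rfl⟩,
      by simp [Gsc, coreSC, (hg j).2]⟩
  have hv1v : (m : ℚ) + 3 ∈ H.label .v1 .v :=
    mem_restrict_label.mpr ⟨⟨.inr (.inr (.inr (.inr (.inr (.inr (.inl ())))))), rfl⟩,
      by simp [Gsc, coreSC]⟩
  have hv2v : (m : ℚ) + 2 ∈ H.label .v2 .v :=
    mem_restrict_label.mpr ⟨⟨.inr (.inr (.inr (.inr (.inr (.inr (.inr (.inl ()))))))), rfl⟩,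
      by simp [Gsc, coreSC]⟩
  have hv1v2 : (m : ℚ) + 4 ∈ H.label .v1 .v2 :=
    mem_restrict_label.mpr ⟨⟨.inr (.inr (.inr (.inr (.inr (.inr (.inr (.inr ()))))))), rfl⟩,
      by simp [Gsc, coreSC]⟩
  clear_value H
  have one {a b} {t : ℚ} (h : t ∈ H.label a b) :
      ∃ p ts₁ ts₂, H.BiPath (· ≤ ·) a b p ts₁ ts₂ := ⟨_, _, _, .of_edge h⟩
  have two {a b c} {t : ℚ} (hab : a ≠ b) (h₁ : t ∈ H.label c a) (h₂ : t ∈ H.label c b) :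
      ∃ p ts₁ ts₂, H.BiPath (· ≤ ·) a b p ts₁ ts₂ :=
    ⟨_, _, _, .of_two_edges hab (by rwa [H.symm]) h₂⟩
  have hsv (j) : (g j : ℚ) + 1 ∈ H.label (.set (g j)) .v := by
    rw [H.symm]
    exact hvs _ (hg j).1
  intro a b hab
  cases a with
  | elem j =>
    cases b with
    | elem j' => exact two hab (hv1u j) (hv1u j')
    | set i => exact two hab (hv1u j) (hv1s i)
    | v => exact two hab (hsu j) (hsv j)
    | v1 => exact one (by rw [H.symm]; exact hv1u j)
    | v2 => exact one (by rw [H.symm]; exact hv2u j)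
  | set i =>
    cases b with
    | elem j => exact two hab (hv1s i) (hv1u j)
    | set i' => exact two hab (hv1s i) (hv1s i')
    | v => exact two hab (hv2s i) hv2v
    | v1 => exact one (by rw [H.symm]; exact hv1s i)
    | v2 => exact one (by rw [H.symm]; exact hv2s i)
  | v =>
    cases b with
    | elem j => exact two hab (hsv j) (hsu j)
    | set i => exact two hab hv2v (hv2s i)
    | v => exact absurd rfl hab
    | v1 => exact one (by rw [H.symm]; exact hv1v)
    | v2 => exact one (by rw [H.symm]; exact hv2v)
  | v1 =>
    cases b with
    | elem j => exact one (hv1u j)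
    | set i => exact one (hv1s i)
    | v => exact one hv1v
    | v1 => exact absurd rfl hab
    | v2 => exact one hv1v2
  | v2 =>
    cases b with
    | elem j => exact one (hv2u j)
    | set i => exact one (hv2s i)
    | v => exact one hv2v
    | v1 => exact one (by rw [H.symm]; exact hv1v2)
    | v2 => exact absurd rfl hab

set_option maxHeartbeats 1000000 in
theorem eq_or_eq_of_mem_Gsc_label {a b x y : Vsc n m} {t : ℚ} (ha : a = .v1 ∨ a = .v2)
    (hab : a ≠ b) (hx : t ∈ (Gsc n m S).label a x) (hy : t ∈ (Gsc n m S).label y b) :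
    x = b ∨ y = a := by
  have hlt (i : Fin m) : (i : ℚ) + 1 ≤ m := mod_cast i.2
  have hj (j : Fin n) : (0 : ℚ) ≤ j := by positivity
  rcases ha with rfl | rfl <;> cases b <;> cases x <;> simp [Gsc, coreSC] at hx hab ⊢ <;>
    cases y <;> simp [Gsc, coreSC] at hy ⊢ <;> grind

/-- In a bi-spanner of `G_SC`, the vertices `v₁` and `v₂` keep all their edges. -/
theorem adj_of_isBiSpanner {H : TemporalGraph (Vsc n m)} (hH : H.IsBiSpanner (Gsc n m S))
    {a b : Vsc n m} (ha : a = .v1 ∨ a = .v2) (hab : a ≠ b) : H.footprint.Adj a b := by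
  obtain ⟨p, ts₁, ts₂, hp⟩ := hH.2 a b hab
  obtain ⟨t, x, y, hx, hy⟩ := hp.exists_common_label (hH.1.1.simple (Gsc_simple S)) hab
  rcases eq_or_eq_of_mem_Gsc_label ha hab (hH.1.1 _ _ hx) (hH.1.1 _ _ hy) with rfl | rfl
  exacts [⟨t, hx⟩, ⟨t, hy⟩]

/-- In a bi-spanner of `G_SC`, every `u_j` is joined to `v` through some `s_i` with
`u_j ∈ S_i`. -/
theorem exists_set_of_isBiSpanner {H : TemporalGraph (Vsc n m)}
    (hH : H.IsBiSpanner (Gsc n m S)) (j : Fin n) :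
    ∃ i, j ∈ S i ∧ H.footprint.Adj (.set i) (.elem j) ∧ H.footprint.Adj .v (.set i) := by
  have hne : Vsc.elem j ≠ (.v : Vsc n m) := by simp
  obtain ⟨p, ts₁, ts₂, hp⟩ := hH.2 _ _ hne
  obtain ⟨t, x, y, hx, hy⟩ := hp.exists_common_label (hH.1.1.simple (Gsc_simple S)) hne
  have hx' := hH.1.1 _ _ hx
  have hy' := hH.1.1 _ _ hy
  have hlt (i : Fin m) : (i : ℚ) + 1 ≤ m := mod_cast i.2
  have hj : (0 : ℚ) ≤ j := by positivity
  cases x with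
  | set i =>
    have hji : j ∈ S i ∧ t = i + 1 := by
      by_cases h : j ∈ S i <;> simp_all [Gsc, coreSC]
    cases y with
    | set i' =>
      have hi' : t = i' + 1 := by simpa [Gsc, coreSC] using hy'
      obtain rfl : i = i' := by
        have : ((i : ℕ) : ℚ) = (i' : ℕ) := by linarith [hji.2]
        exact Fin.ext (mod_cast this)
      exact ⟨i, hji.1, ⟨t, by rwa [H.symm]⟩, ⟨t, by rwa [H.symm]⟩⟩
    | _ => simp [Gsc, coreSC] at hy' <;> grind
  | _ => simp [Gsc, coreSC] at hx' <;> cases y <;> simp [Gsc, coreSC] at hy' <;> grind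

end

/-- correctness of the reduction from Set Cover: there is a set cover
of size at most `k` (indices `i_1, …, i_k` with `S_{i_1} ∪ … ∪ S_{i_k} = U`) if and
only if `G_SC` admits a bidirectional temporal spanner whose footprint has at most
`3n + 2m + 3 + k` edges. -/
theorem stmt18 (n m : ℕ) (S : Fin m → Finset (Fin n))
    (hcover : ∀ j : Fin n, ∃ i : Fin m, j ∈ S i) (k : ℕ) :
    (∃ I : Finset (Fin m), I.card ≤ k ∧ ∀ j : Fin n, ∃ i ∈ I, j ∈ S i) ↔
    (∃ H : TemporalGraph (Vsc n m), H.IsBiSpanner (Gsc n m S) ∧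
      H.footprint.edgeSet.ncard ≤ 3 * n + 2 * m + 3 + k) := by
  constructor
  · rintro ⟨I, hI, hcov⟩
    choose g hg using hcov
    refine ⟨(Gsc n m S).restrict (Set.range (spannerEdge g I)),
      ⟨⟨TemporalGraph.restrict_isSubgraph _ _, ?_⟩, biConnected_restrict_spannerEdge hg⟩, ?_⟩
    · exact (biConnected_restrict_spannerEdge hg).temporallyConnected
    · refine (Set.ncard_le_ncard (TemporalGraph.restrict_edgeSet_subset _ _) (Set.finite_range _)).trans ?_
      rw [ncard_range_spannerEdge]
      omega
  · rintro ⟨H, hH, hcard⟩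
    classical
    choose g hgS hgu hgv using exists_set_of_isBiSpanner hH
    refine ⟨Finset.univ.image g, ?_, fun j => ⟨g j, by simp, hgS j⟩⟩
    have hsub : Set.range (spannerEdge g (Finset.univ.image g)) ⊆ H.footprint.edgeSet := by
      rintro _ ⟨(i | i | ⟨i, hi⟩ | j | j | j | _ | _ | _), rfl⟩
      case inr.inr.inl =>
        obtain ⟨j, -, rfl⟩ := Finset.mem_image.mp hi
        exact hgv j
      case inr.inr.inr.inr.inr.inl => exact hgu j
      all_goals exact adj_of_isBiSpanner hH (by simp) (by simp)
    have hfin : H.footprint.edgeSet.Finite := by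
      have : Finite (Vsc n m) :=
        .of_surjective (fun
          | .inl j => .elem j
          | .inr (.inl i) => .set i
          | .inr (.inr 0) => .v
          | .inr (.inr 1) => .v1
          | .inr (.inr 2) => .v2 : Fin n ⊕ Fin m ⊕ Fin 3 → Vsc n m) <| by
          rintro (j | i | _ | _ | _)
          exacts [⟨.inl j, rfl⟩, ⟨.inr (.inl i), rfl⟩, ⟨.inr (.inr 0), rfl⟩,
            ⟨.inr (.inr 1), rfl⟩, ⟨.inr (.inr 2), rfl⟩]
      exact Set.toFinite _
    have := Set.ncard_le_ncard hsub hfin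
    rw [ncard_range_spannerEdge] at this
    omega

end TemporalPaper
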